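/- arXiv:2312.14351 — 2 statements merged into one kernel-verified Lean document; each statement's English description precedes it below -/
import Mathlib

section
/- For every integer n ≥ 3, the number of permutations π in S_n such that π avoids both of the patterns 213 and 312 and π² avoids the pattern 132 equals n + 1. -/
/-- A permutation `π` of `Fin n` contains the pattern `τ` (a permutation of `Fin m`)
if there is a strictly increasing choice of `m` indices on which `π` is
order-isomorphic to `τ`. -/
def PermContains {n m : ℕ} (π : Equiv.Perm (Fin n)) (τ : Equiv.Perm (Fin m)) : Prop :=
  ∃ f : Fin m → Fin n, StrictMono f ∧ ∀ i j : Fin m, τ i < τ j ↔ π (f i) < π (f j)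

/-- `π` avoids the pattern `τ`. -/
def PermAvoids {n m : ℕ} (π : Equiv.Perm (Fin n)) (τ : Equiv.Perm (Fin m)) : Prop :=
  ¬ PermContains π τ

/-- The pattern 123 (one-line notation), as a permutation of `Fin 3`. -/
def p123 : Equiv.Perm (Fin 3) := ⟨![0,1,2], ![0,1,2], by decide, by decide⟩
/-- The pattern 132. -/
def p132 : Equiv.Perm (Fin 3) := ⟨![0,2,1], ![0,2,1], by decide, by decide⟩
/-- The pattern 213. -/
def p213 : Equiv.Perm (Fin 3) := ⟨![1,0,2], ![1,0,2], by decide, by decide⟩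
/-- The pattern 231. -/
def p231 : Equiv.Perm (Fin 3) := ⟨![1,2,0], ![2,0,1], by decide, by decide⟩
/-- The pattern 312. -/
def p312 : Equiv.Perm (Fin 3) := ⟨![2,0,1], ![1,2,0], by decide, by decide⟩
/-- The pattern 321. -/
def p321 : Equiv.Perm (Fin 3) := ⟨![2,1,0], ![2,1,0], by decide, by decide⟩

theorem permContains_p132_iff {n : ℕ} (σ : Equiv.Perm (Fin n)) :
    PermContains σ p132 ↔ ∃ i j k, i < j ∧ j < k ∧ σ i < σ k ∧ σ k < σ j := by
  constructor
  · rintro ⟨f, hf, h⟩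
    exact ⟨f 0, f 1, f 2, hf (by decide), hf (by decide), (h 0 2).1 (by decide),
      (h 2 1).1 (by decide)⟩
  · rintro ⟨i, j, k, hij, hjk, h₁, h₂⟩
    refine ⟨![i, j, k], ?_, ?_⟩
    · intro a b hab
      fin_cases a <;> fin_cases b <;> simp at hab ⊢ <;> order
    · intro a b
      fin_cases a <;> fin_cases b <;> simp [p132] <;> order

theorem permContains_p213_iff {n : ℕ} (σ : Equiv.Perm (Fin n)) :
    PermContains σ p213 ↔ ∃ i j k, i < j ∧ j < k ∧ σ j < σ i ∧ σ i < σ k := by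
  constructor
  · rintro ⟨f, hf, h⟩
    exact ⟨f 0, f 1, f 2, hf (by decide), hf (by decide), (h 1 0).1 (by decide),
      (h 0 2).1 (by decide)⟩
  · rintro ⟨i, j, k, hij, hjk, h₁, h₂⟩
    refine ⟨![i, j, k], ?_, ?_⟩
    · intro a b hab
      fin_cases a <;> fin_cases b <;> simp at hab ⊢ <;> order
    · intro a b
      fin_cases a <;> fin_cases b <;> simp [p213] <;> order

theorem permContains_p312_iff {n : ℕ} (σ : Equiv.Perm (Fin n)) :
    PermContains σ p312 ↔ ∃ i j k, i < j ∧ j < k ∧ σ j < σ k ∧ σ k < σ i := by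
  constructor
  · rintro ⟨f, hf, h⟩
    exact ⟨f 0, f 1, f 2, hf (by decide), hf (by decide), (h 1 2).1 (by decide),
      (h 2 0).1 (by decide)⟩
  · rintro ⟨i, j, k, hij, hjk, h₁, h₂⟩
    refine ⟨![i, j, k], ?_, ?_⟩
    · intro a b hab
      fin_cases a <;> fin_cases b <;> simp at hab ⊢ <;> order
    · intro a b
      fin_cases a <;> fin_cases b <;> simp [p312] <;> order

/-- A permutation avoids both 213 and 312 exactly when its one-line notation has no valley. -/
theorem permAvoids_p213_and_p312_iff {n : ℕ} (π : Equiv.Perm (Fin n)) :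
    PermAvoids π p213 ∧ PermAvoids π p312 ↔
      ∀ i j k, i < j → j < k → π j < π i → π k < π j := by
  rw [PermAvoids, PermAvoids, permContains_p213_iff, permContains_p312_iff]
  push Not
  constructor
  · rintro ⟨h₁, h₂⟩ i j k hij hjk hji
    by_contra! hkj
    have hne : π j ≠ π k := π.injective.ne hjk.ne
    have h₁ := h₁ i j k hij hjk hji
    have h₂ := h₂ i j k hij hjk (lt_of_le_of_ne hkj hne)
    exact (hij.trans hjk).ne (π.injective (le_antisymm h₂ h₁))
  · intro h
    refine ⟨fun i j k hij hjk hji => ((h i j k hij hjk hji).trans hji).le,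
      fun i j k hij hjk hjk' => ?_⟩
    by_contra! hki
    exact (h i j k hij hjk (hjk'.trans hki)).asymm hjk'

/-- Two permutations with the same relative order are equal. -/
theorem perm_eq_of_lt_imp_lt {n : ℕ} {π ρ : Equiv.Perm (Fin n)}
    (h : ∀ i j, ρ i < ρ j → π i < π j) : π = ρ := by
  have hmono : StrictMono (ρ.symm.trans π) := fun x y hxy =>
    h _ _ (by simpa using hxy)
  have hle : ∀ x y, (ρ.symm.trans π) x ≤ (ρ.symm.trans π) y ↔ x ≤ y :=
    fun _ _ => hmono.le_iff_le
  have hid : (⟨ρ.symm.trans π, hle _ _⟩ : Fin n ≃o Fin n) = OrderIso.refl _ :=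
    Subsingleton.elim _ _
  ext i
  simpa using congrArg Fin.val (DFunLike.congr_fun hid (ρ i))

section Unimodal

variable {n : ℕ} {π : Equiv.Perm (Fin (n + 1))} {m : Fin (n + 1)}

theorem lt_of_lt_of_le_peak
    (hπ : ∀ i j k, i < j → j < k → π j < π i → π k < π j) (hm : π m = Fin.last n)
    {i j : Fin (n + 1)} (hij : i < j) (hj : j ≤ m) : π i < π j := by
  have hne : π i ≠ π j := π.injective.ne hij.ne
  by_contra hlt
  have hji : π j < π i := lt_of_le_of_ne (not_lt.1 hlt) hne.symm
  rcases hj.lt_or_eq with hj | rfl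
  · exact absurd (hπ i j m hij hj hji) (by simpa [hm] using Fin.le_last _)
  · exact absurd hji (by simpa [hm] using Fin.le_last _)

theorem lt_of_peak_le_of_lt
    (hπ : ∀ i j k, i < j → j < k → π j < π i → π k < π j) (hm : π m = Fin.last n)
    {i j : Fin (n + 1)} (hi : m ≤ i) (hij : i < j) : π j < π i := by
  have hne : ∀ {a b}, a < b → π a ≠ π b := fun h => π.injective.ne h.ne
  rcases hi.lt_or_eq with hi | rfl
  · exact hπ m i j hi hij (lt_of_le_of_ne (by simpa [hm] using Fin.le_last _) (hne hi).symm)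
  · exact lt_of_le_of_ne (by simpa [hm] using Fin.le_last _) (hne hij).symm

end Unimodal

/-- The involution of `Fin (n + 1)` that fixes the indices below `k` and reverses the others. -/
def tailRev (n : ℕ) (k : Fin (n + 1)) : Equiv.Perm (Fin (n + 1)) :=
  Function.Involutive.toPerm
    (fun i => if h : i < k then i else
      ⟨n + k - i, by have := i.2; have := k.2; rw [Fin.lt_def] at h; omega⟩) (by
      intro i
      have := i.2
      have := k.2
      ext
      simp only [Fin.lt_def]
      split_ifs <;> grind)

theorem tailRev_val (n : ℕ) (k i : Fin (n + 1)) :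
    (tailRev n k i : ℕ) = if (i : ℕ) < k then (i : ℕ) else n + k - i := by
  simp only [tailRev, Function.Involutive.coe_toPerm, Fin.lt_def]
  split_ifs <;> rfl

theorem tailRev_sq (n : ℕ) (k : Fin (n + 1)) : tailRev n k ^ 2 = 1 := by
  ext i
  rw [pow_two, Equiv.Perm.mul_apply]
  exact congrArg Fin.val ((tailRev n k).symm_apply_apply i)

theorem finRotate_val (n : ℕ) (i : Fin (n + 1)) :
    (finRotate (n + 1) i : ℕ) = if (i : ℕ) < n then (i : ℕ) + 1 else 0 := by
  rw [coe_finRotate]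
  have := i.2
  simp only [Fin.ext_iff, Fin.val_last]
  split_ifs <;> omega

/-- A unimodal involution is a tail reversal. -/
theorem eq_tailRev_of_sq_eq_one {n : ℕ} {π : Equiv.Perm (Fin (n + 1))}
    (hπ : ∀ i j k, i < j → j < k → π j < π i → π k < π j) (hsq : π ^ 2 = 1) :
    π = tailRev n (π (Fin.last n)) := by
  have hinv : ∀ i, π (π i) = i := fun i => by
    simpa [pow_two] using DFunLike.congr_fun hsq i
  have hm := hinv (Fin.last n)
  set m := π (Fin.last n) with hlast
  have hge : ∀ i, m ≤ i → m ≤ π i := fun i hi => by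
    rcases (Fin.le_last i).lt_or_eq with h | rfl
    · exact (hlast ▸ lt_of_peak_le_of_lt hπ hm hi h).le
    · exact hlast.le
  have hlt : ∀ i, i < m → π i < m := fun i hi => by
    by_contra! h
    exact absurd (hge _ h) (by simpa [hinv] using hi)
  apply perm_eq_of_lt_imp_lt
  intro i j hij
  rw [Fin.lt_def, tailRev_val, tailRev_val] at hij
  have hi := i.2
  have hj := j.2
  split_ifs at hij with h₁ h₂ h₂
  · exact lt_of_lt_of_le_peak hπ hm hij (Fin.lt_def.2 h₂).le
  · exact (hlt i h₁).trans_le (hge j (not_lt.1 h₂))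
  · omega
  · exact lt_of_peak_le_of_lt hπ hm (not_lt.1 h₂) (Fin.lt_def.2 (by omega))

theorem sq_eq_one_of_map_zero {n : ℕ} {π : Equiv.Perm (Fin (n + 1))}
    (hσ : ¬ PermContains (π ^ 2) p132) (h0 : π 0 = 0) : π ^ 2 = 1 := by
  rw [permContains_p132_iff] at hσ
  push Not at hσ
  have hσ0 : (π ^ 2) 0 = 0 := by simp [pow_two, h0]
  have hpos : ∀ i, 0 < i → 0 < (π ^ 2) i := fun i hi =>
    Fin.pos_iff_ne_zero.2 fun h => hi.ne' ((π ^ 2).injective (h.trans hσ0.symm))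
  apply perm_eq_of_lt_imp_lt
  intro i j hij
  simp only [Equiv.Perm.one_apply] at hij
  rcases (Fin.zero_le i).eq_or_lt with rfl | hi
  · simpa only [hσ0] using hpos j hij
  · exact lt_of_le_of_ne (hσ 0 i j hi hij (by simpa only [hσ0] using hpos j (hi.trans hij)))
      ((π ^ 2).injective.ne hij.ne)

theorem eq_tailRev_or_eq_finRotate {n : ℕ} (hn : 2 ≤ n) {π : Equiv.Perm (Fin (n + 1))}
    (hπ : ∀ i j k, i < j → j < k → π j < π i → π k < π j)
    (hσ : ¬ PermContains (π ^ 2) p132) :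
    (∃ k, π = tailRev n k) ∨ π = finRotate (n + 1) := by
  have hval : ∀ {i j}, (π i : ℕ) = π j → i = j := fun h => π.injective (Fin.ext h)
  obtain ⟨z, hz⟩ := π.surjective 0
  rcases (Fin.zero_le z).eq_or_lt with rfl | hz0
  · exact .inl ⟨_, eq_tailRev_of_sq_eq_one hπ (sq_eq_one_of_map_zero hσ hz)⟩
  have hzl : z = Fin.last n := by
    by_contra h
    have hlt : z < Fin.last n := lt_of_le_of_ne (Fin.le_last z) h
    have h0 : π z < π 0 := by
      rw [hz]
      exact Fin.pos_iff_ne_zero.2 fun h => hz0.ne (π.injective (h.trans hz.symm))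
    exact absurd (hπ 0 z _ hz0 hlt h0) (by simp [hz])
  subst hzl
  rw [permContains_p132_iff] at hσ
  push Not at hσ
  have hsq : ∀ i, (π ^ 2) i = π (π i) := fun i => by simp [pow_two]
  simp only [hsq] at hσ
  obtain ⟨m, hm⟩ := π.surjective (Fin.last n)
  obtain ⟨p, hp⟩ := π.surjective ⟨1, by omega⟩
  have hpv : (π p : ℕ) = 1 := by rw [hp]
  have hzv : (π (Fin.last n) : ℕ) = 0 := by rw [hz]; rfl
  obtain ⟨q, hq⟩ : ∃ q : Fin (n + 1), (q : ℕ) = n - 1 := ⟨⟨n - 1, by omega⟩, rfl⟩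
  have hmono := fun {i j} => lt_of_lt_of_le_peak (i := i) (j := j) hπ hm
  have hanti := fun {i j} => lt_of_peak_le_of_lt (i := i) (j := j) hπ hm
  have hmn : m ≠ Fin.last n := by
    rintro rfl
    simp [hz, Fin.ext_iff] at hm
    omega
  have hpn : p ≠ Fin.last n := by
    rintro rfl
    simp [hz, Fin.ext_iff] at hp
  have hmn' := Fin.lt_last_iff_ne_last.2 hmn
  have hσm : π (π m) = 0 := by rw [hm, hz]
  have hql : q < Fin.last n := Fin.lt_def.2 (by simp [hq]; omega)
  -- the value 1 sits at one end of the remaining word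
  have hpq : p = 0 ∨ p = q := by
    by_contra! h
    have hp0 : 0 < p := Fin.pos_iff_ne_zero.2 h.1
    have hlt : p < q := by
      have := p.2
      have h₂ := h.2
      simp only [ne_eq, Fin.ext_iff, Fin.lt_def, hq, Fin.val_last] at *
      omega
    have big : ∀ i, i ≠ p → i < Fin.last n → π p < π i := fun i hi hil => by
      have h₁ : (π i : ℕ) ≠ π p := fun h => hi (hval h)
      have h₂ : (π i : ℕ) ≠ π (Fin.last n) := fun h => hil.ne (hval h)
      rw [Fin.lt_def]
      omega
    exact (hπ 0 p q hp0 hlt (big 0 hp0.ne (hp0.trans (hlt.trans hql)))).asymm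
      (big q hlt.ne' hql)
  have hmq : m ≤ q := by
    simp only [Fin.lt_def, Fin.le_def, hq, Fin.val_last] at *
    omega
  rcases hpq with rfl | rfl
  · right
    have hmq' : m = q := by
      by_contra hne
      have hlt := lt_of_le_of_ne hmq hne
      have hle := hσ m q _ hlt hql (by rw [hσm, hz, hp]; simp [Fin.lt_def])
      rw [hz, hp] at hle
      have h₁ : (π (π q) : ℕ) ≠ π 0 := fun h => by
        have := hval h
        rw [← hz] at this
        exact hql.ne (hval (by rw [this]))
      have h₂ : (π (π q) : ℕ) ≠ π (π m) := fun h => hlt.ne' (hval (by rw [hval h]))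
      rw [hp] at h₁
      rw [hσm] at h₂
      simp [Fin.le_def] at h₁ h₂ hle
      omega
    subst hmq'
    apply perm_eq_of_lt_imp_lt
    intro i j hij
    rw [Fin.lt_def, finRotate_val, finRotate_val] at hij
    have hi := i.2
    have hj := j.2
    split_ifs at hij with h₁ h₂ h₂
    · exact hmono (Fin.lt_def.2 (by omega)) (Fin.le_def.2 (by simp [hq]; omega))
    · omega
    · have hil : i = Fin.last n := Fin.ext (by simp; omega)
      subst hil
      rw [hz]
      refine Fin.pos_iff_ne_zero.2 fun h => ?_
      rw [← hz] at h
      rw [π.injective h] at h₂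
      simp at h₂
    · omega
  · left
    have hm0 : m = 0 := by
      by_contra hne
      have hmpos : 0 < m := Fin.pos_iff_ne_zero.2 hne
      have hltq : m < p := lt_of_le_of_ne hmq fun h => by
        rw [h, hp, Fin.ext_iff] at hm
        simp at hm
        omega
      have h01 : π 0 < π ⟨1, by omega⟩ :=
        hmono (Fin.lt_def.2 (by simp)) (Fin.le_def.2 hmpos)
      have hle := hσ m p _ hltq hql (by
        rw [hσm, hz]
        refine Fin.pos_iff_ne_zero.2 fun h => ?_
        rw [← hz] at h
        have := π.injective h
        simp [Fin.ext_iff] at this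
        omega)
      rw [hp, hz] at hle
      exact absurd h01 hle.not_gt
    subst hm0
    refine ⟨0, perm_eq_of_lt_imp_lt fun i j hij => hanti (Fin.zero_le _) ?_⟩
    rw [Fin.lt_def, tailRev_val, tailRev_val] at hij
    simp at hij
    rw [Fin.lt_def]
    omega

theorem tailRev_no_valley (n : ℕ) (l i j k : Fin (n + 1)) (hij : i < j) (hjk : j < k)
    (h : tailRev n l j < tailRev n l i) : tailRev n l k < tailRev n l j := by
  simp only [Fin.lt_def, tailRev_val] at *
  have := l.2
  have := k.2
  split_ifs at * <;> omega

theorem finRotate_no_valley (n : ℕ) (i j k : Fin (n + 1)) (hij : i < j) (hjk : j < k)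
    (h : finRotate (n + 1) j < finRotate (n + 1) i) :
    finRotate (n + 1) k < finRotate (n + 1) j := by
  simp only [Fin.lt_def, finRotate_val] at *
  have := k.2
  split_ifs at * <;> omega

theorem not_permContains_one_p132 (n : ℕ) :
    ¬ PermContains (1 : Equiv.Perm (Fin n)) p132 := by
  rw [permContains_p132_iff]
  rintro ⟨i, j, k, -, hjk, -, hkj⟩
  exact hjk.asymm hkj

theorem not_permContains_finRotate_sq_p132 (n : ℕ) :
    ¬ PermContains (finRotate (n + 1) ^ 2) p132 := by
  rw [permContains_p132_iff]
  rintro ⟨i, j, k, hij, hjk, h₁, h₂⟩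
  simp only [pow_two, Equiv.Perm.mul_apply, Fin.lt_def, finRotate_val] at *
  have := k.2
  grind

theorem option_elim_finRotate_tailRev_injective {n : ℕ} (hn : 2 ≤ n) :
    Function.Injective fun o : Option (Fin (n + 1)) =>
      o.elim (finRotate (n + 1)) (tailRev n) := by
  have hne : ∀ k, tailRev n k ≠ finRotate (n + 1) := fun k h => by
    have h₀ := congrArg Fin.val (DFunLike.congr_fun h 0)
    have h₁ := congrArg Fin.val (DFunLike.congr_fun h (Fin.last n))
    rw [tailRev_val, finRotate_val] at h₀ h₁
    simp at h₀ h₁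
    grind
  rintro (_ | k) (_ | l) h
  · rfl
  · exact absurd h.symm (hne l)
  · exact absurd h (hne k)
  · have h₁ := congrArg Fin.val (DFunLike.congr_fun h (Fin.last n))
    have := k.2
    have := l.2
    simp only [Option.elim_some, tailRev_val, Fin.val_last] at h₁
    congr 1
    ext
    split_ifs at h₁ <;> omega

theorem stmt1 (n : ℕ) (hn : 3 ≤ n) :
    Nat.card {π : Equiv.Perm (Fin n) //
      PermAvoids π p213 ∧ PermAvoids π p312 ∧ PermAvoids (π ^ 2) p132} = n + 1 := by
  obtain ⟨n, rfl⟩ : ∃ k, n = k + 1 := ⟨n - 1, by omega⟩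
  have hn : 2 ≤ n := by omega
  have hset : {π : Equiv.Perm (Fin (n + 1)) |
      PermAvoids π p213 ∧ PermAvoids π p312 ∧ PermAvoids (π ^ 2) p132} =
      Set.range fun o : Option (Fin (n + 1)) => o.elim (finRotate (n + 1)) (tailRev n) := by
    ext π
    rw [Set.mem_ofPred_eq, ← and_assoc, permAvoids_p213_and_p312_iff, Set.mem_range]
    constructor
    · rintro ⟨hπ, hσ⟩
      rcases eq_tailRev_or_eq_finRotate hn hπ hσ with ⟨k, rfl⟩ | rfl
      · exact ⟨some k, rfl⟩
      · exact ⟨none, rfl⟩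
    · rintro ⟨_ | k, rfl⟩
      · exact ⟨finRotate_no_valley n, not_permContains_finRotate_sq_p132 n⟩
      · refine ⟨tailRev_no_valley n k, ?_⟩
        simp only [Option.elim_some, tailRev_sq]
        exact not_permContains_one_p132 _
  have hcard := Nat.card_range_of_injective (option_elim_finRotate_tailRev_injective hn)
  rw [← hset] at hcard
  exact hcard.trans (by simp)
end

section
/- For every integer n ≥ 1, the number of permutations π in S_n such that π avoids both of the patterns 213 and 312 and π² avoids the pattern 312 equals ⌊n²/4⌋ + 1. -/
theorem permAvoids_p213_iff {n : ℕ} (π : Equiv.Perm (Fin n)) :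
    PermAvoids π p213 ↔ ∀ i j k : Fin n, i < j → j < k → ¬(π j < π i ∧ π i < π k) := by
  constructor
  · rintro h i j k hij hjk ⟨h1, h2⟩
    refine h ⟨![i, j, k], ?_, ?_⟩
    · rw [Fin.strictMono_iff_lt_succ]
      intro x
      fin_cases x <;> simpa
    · intro x y
      fin_cases x <;> fin_cases y <;> simp [p213, h1, h2, h1.le, h2.le, h1.trans h2, (h1.trans h2).le]
  · rintro h ⟨f, hf, hp⟩
    exact h (f 0) (f 1) (f 2) (hf (by decide)) (hf (by decide))
      ⟨(hp 1 0).1 (by decide), (hp 0 2).1 (by decide)⟩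

theorem permAvoids_p312_iff {n : ℕ} (π : Equiv.Perm (Fin n)) :
    PermAvoids π p312 ↔ ∀ i j k : Fin n, i < j → j < k → ¬(π j < π k ∧ π k < π i) := by
  constructor
  · rintro h i j k hij hjk ⟨h1, h2⟩
    refine h ⟨![i, j, k], ?_, ?_⟩
    · rw [Fin.strictMono_iff_lt_succ]
      intro x
      fin_cases x <;> simpa
    · intro x y
      fin_cases x <;> fin_cases y <;> simp [p312, h1, h2, h1.le, h2.le, h1.trans h2, (h1.trans h2).le]
  · rintro h ⟨f, hf, hp⟩
    exact h (f 0) (f 1) (f 2) (hf (by decide)) (hf (by decide))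
      ⟨(hp 1 2).1 (by decide), (hp 2 0).1 (by decide)⟩

/-- In zero-based one-line notation on `n` letters: the word that fixes the first `a` letters,
then lists the `k` largest letters increasingly, then the remaining letters decreasingly. -/
def blockFun (n a k i : ℕ) : ℕ :=
  if i < a then i else if i < a + k then i + (n - a - k) else n - 1 + a - i

/-- The inverse of `blockFun n a k`. -/
def blockInv (n a k v : ℕ) : ℕ :=
  if v < a then v else if v < n - k then n - 1 + a - v else v - (n - a - k)

/-- `blockFun n a k` as a permutation. -/
def blockPerm (n a k : ℕ) (h : a + k ≤ n) : Equiv.Perm (Fin n) where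
  toFun i := ⟨blockFun n a k i, by have := i.2; unfold blockFun; split_ifs <;> omega⟩
  invFun i := ⟨blockInv n a k i, by have := i.2; unfold blockInv; split_ifs <;> omega⟩
  left_inv i := by
    have := i.2
    ext
    simp only [blockFun, blockInv]
    split_ifs <;> omega
  right_inv i := by
    have := i.2
    ext
    simp only [blockFun, blockInv]
    split_ifs <;> omega

theorem blockFun_avoids_213 {n a k x y z : ℕ} (hxy : x < y) (hyz : y < z) (hz : z < n)
    (hk : a + k ≤ n) :
    ¬(blockFun n a k y < blockFun n a k x ∧ blockFun n a k x < blockFun n a k z) := by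
  unfold blockFun
  split_ifs <;> omega

theorem blockFun_avoids_312 {n a k x y z : ℕ} (hxy : x < y) (hyz : y < z) (hz : z < n)
    (hk : a + k ≤ n) :
    ¬(blockFun n a k y < blockFun n a k z ∧ blockFun n a k z < blockFun n a k x) := by
  unfold blockFun
  split_ifs <;> omega

theorem blockFun_blockFun {n a k i : ℕ} (hi : i < n) (hk : a + 2 * k ≤ n) :
    blockFun n a k (blockFun n a k i) =
      if i < a then i else if i < a + k then a + k - 1 + a - i
      else if i < n - k then i else n - k + (n - 1 - i) := by
  unfold blockFun
  split_ifs <;> omega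

theorem blockFun_sq_avoids_312 {n a k x y z : ℕ} (hxy : x < y) (hyz : y < z) (hz : z < n)
    (hk : a + 2 * k ≤ n) :
    ¬(blockFun n a k (blockFun n a k y) < blockFun n a k (blockFun n a k z) ∧
      blockFun n a k (blockFun n a k z) < blockFun n a k (blockFun n a k x)) := by
  rw [blockFun_blockFun (by omega) hk, blockFun_blockFun (by omega) hk,
    blockFun_blockFun (by omega) hk]
  split_ifs <;> omega

theorem blockPerm_avoids {n a k : ℕ} (h : a + 2 * k ≤ n) :
    PermAvoids (blockPerm n a k (by omega)) p213 ∧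
    PermAvoids (blockPerm n a k (by omega)) p312 ∧
    PermAvoids (blockPerm n a k (by omega) ^ 2) p312 := by
  simp only [permAvoids_p213_iff, permAvoids_p312_iff]
  refine ⟨fun x y z hxy hyz => ?_, fun x y z hxy hyz => ?_, fun x y z hxy hyz => ?_⟩
  · exact blockFun_avoids_213 hxy hyz z.2 (by omega)
  · exact blockFun_avoids_312 hxy hyz z.2 (by omega)
  · exact blockFun_sq_avoids_312 hxy hyz z.2 h

/-- If `q` is a permutation of `range n` avoiding `312` and ending in `c`, then `q` preserves
`range c`. -/
theorem lt_of_avoids_312_of_last {n c : ℕ} {q : ℕ → ℕ}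
    (inj : ∀ i < n, ∀ j < n, q i = q j → i = j)
    (surj : ∀ v < n, ∃ i < n, q i = v)
    (h312 : ∀ x y z, x < y → y < z → z < n → ¬(q y < q z ∧ q z < q x))
    (hc : c < n) (hlast : q (n - 1) = c) {i : ℕ} (hi : i < c) : q i < c := by
  by_contra! hq
  have hne : q i ≠ c := fun h => by
    have := inj i (by omega) (n - 1) (by omega) (h.trans hlast.symm)
    omega
  have hsub : Finset.range c ⊆ (Finset.range i).image q := by
    intro v hv
    rw [Finset.mem_range] at hv
    obtain ⟨j, hj, rfl⟩ := surj v (by omega)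
    refine Finset.mem_image.2 ⟨j, Finset.mem_range.2 ?_, rfl⟩
    by_contra! hij
    have hji : j ≠ i := by rintro rfl; omega
    have hjl : j ≠ n - 1 := by rintro rfl; omega
    exact h312 i j (n - 1) (by omega) (by omega) (by omega) ⟨by omega, by omega⟩
  have h1 := (Finset.card_le_card hsub).trans Finset.card_image_le
  simp only [Finset.card_range] at h1
  omega

theorem eq_blockFun_of_avoids {n : ℕ} {g : ℕ → ℕ}
    (hlt : ∀ i < n, g i < n)
    (inj : ∀ i < n, ∀ j < n, g i = g j → i = j)
    (surj : ∀ v < n, ∃ i < n, g i = v)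
    (h213 : ∀ x y z, x < y → y < z → z < n → ¬(g y < g x ∧ g x < g z))
    (h312 : ∀ x y z, x < y → y < z → z < n → ¬(g y < g z ∧ g z < g x))
    (hsq : ∀ x y z, x < y → y < z → z < n → ¬(g (g y) < g (g z) ∧ g (g z) < g (g x))) :
    (∀ i < n, g i = i) ∨
      ∃ a k, 1 ≤ k ∧ a + 2 * k ≤ n ∧ ∀ i < n, g i = blockFun n a k i := by
  classical
  by_cases hid : ∀ i < n, g i = i
  · exact Or.inl hid
  right
  push Not at hid
  obtain ⟨a, ⟨han, hane⟩, hmin⟩ : ∃ a, (a < n ∧ g a ≠ a) ∧ ∀ i < a, g i = i := by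
    refine ⟨Nat.find hid, Nat.find_spec hid, fun i hi => ?_⟩
    have h1 := Nat.find_min hid hi
    have h2 := (Nat.find_spec hid).1
    by_contra h
    exact h1 ⟨by omega, h⟩
  have hge : ∀ i, a ≤ i → i < n → a ≤ g i := by
    intro i hai hin
    by_contra! h
    have := inj _ (by omega) i hin (hmin _ h)
    omega
  have hca : a < g a := lt_of_le_of_ne (hge a le_rfl han) (Ne.symm hane)
  obtain ⟨c, hc⟩ : ∃ c, g a = c := ⟨_, rfl⟩
  have hcn : c < n := hc ▸ hlt a han
  have hdec : ∀ v, a ≤ v → v < c → g (n - 1 + a - v) = v := by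
    intro v
    induction v using Nat.strong_induction_on with
    | _ v ih =>
      intro hav hvc
      obtain ⟨p, hp, hpv⟩ := surj v (by omega)
      have hap : a < p := by
        rcases lt_trichotomy p a with h | h | h
        · have := hmin p h; omega
        · subst h; omega
        · exact h
      have hpq : p ≤ n - 1 + a - v := by
        by_contra! h
        have h1 := ih (n - 1 + a - p) (by omega) (by omega) (by omega)
        rw [show n - 1 + a - (n - 1 + a - p) = p by omega] at h1
        omega
      rcases hpq.eq_or_lt with h | h
      · rw [← h, hpv]
      exfalso
      have hq1 := hge (n - 1 + a - v) (by omega) (by omega)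
      have hqn : n - 1 + a - v < n := by omega
      have hq2 : v < g (n - 1 + a - v) := by
        by_contra! hle
        rcases hle.eq_or_lt with h2 | h2
        · have := inj p hp _ hqn (by omega)
          omega
        · have h3 := ih _ h2 hq1 (by omega)
          have := inj _ (by omega) _ hqn h3
          omega
      have hne : g (n - 1 + a - v) ≠ c := fun h2 => by
        have := inj _ hqn a han (by omega)
        omega
      have h4 := h213 a p _ hap h hqn
      have h5 := h312 a p _ hap h hqn
      omega
  have hlast : g (n - 1) = a := by
    have := hdec a le_rfl (by omega)
    rwa [show n - 1 + a - a = n - 1 by omega] at this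
  have hpres : ∀ i < c, g (g i) < c := fun i hi =>
    lt_of_avoids_312_of_last (q := fun i => g (g i))
      (fun i hi j hj h => inj i hi j hj (inj _ (hlt i hi) _ (hlt j hj) h))
      (fun v hv => by
        obtain ⟨w, hw, rfl⟩ := surj v hv
        obtain ⟨u, hu, rfl⟩ := surj w hw
        exact ⟨u, hu, rfl⟩) hsq hcn (by simp only [hlast, hc]) hi
  have hbound : n + a - c ≤ c := by
    have h1 := hpres a (by omega)
    have h2 := hdec _ (hge _ (hge a le_rfl han) (hlt a han)) h1
    rw [hc] at h1 h2
    have h3 := hge c (by omega) hcn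
    have := inj _ (by omega) c hcn h2
    omega
  have htail : ∀ i, n + a - c ≤ i → i < n → g i = n - 1 + a - i := by
    intro i h1 h2
    have := hdec (n - 1 + a - i) (by omega) (by omega)
    rwa [show n - 1 + a - (n - 1 + a - i) = i by omega] at this
  have hbig : ∀ i, a ≤ i → i < n + a - c → c ≤ g i := by
    intro i h1 h2
    by_contra! h
    have h3 := hge i h1 (by omega)
    have := inj _ (by omega) i (by omega) (hdec (g i) h3 h)
    omega
  have hmono : ∀ i, a ≤ i → i + 1 < n + a - c → g i < g (i + 1) := by
    intro i h1 h2
    have b1 := hbig i h1 (by omega)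
    have b2 := hbig (i + 1) (by omega) h2
    by_contra! h
    have n1 : g i ≠ g (i + 1) := fun e => by
      have := inj _ (by omega) _ (by omega) e
      omega
    have n2 : g (i + 1) ≠ c := fun e => by
      have := inj _ (by omega) a han (e.trans hc.symm)
      omega
    have n3 : a ≠ i := by rintro rfl; omega
    have l1 := hlt i (by omega)
    have h3 := hsq a i (i + 1) (by omega) (by omega) (by omega)
    rw [hc, htail c (by omega) hcn, htail (g i) (by omega) l1,
      htail (g (i + 1)) (by omega) (by omega)] at h3
    omega
  have hlow : ∀ d, a + d < n + a - c → c + d ≤ g (a + d) := by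
    intro d
    induction d with
    | zero => intro _; simp [hc]
    | succ d ih =>
      intro h
      have h1 := ih (by omega)
      have h2 := hmono (a + d) (by omega) (by omega)
      rw [← Nat.add_assoc a]
      omega
  have hup : ∀ d, d < n - c → g (n + a - c - 1 - d) ≤ n - 1 - d := by
    intro d
    induction d with
    | zero => intro h; have := hlt (n + a - c - 1 - 0) (by omega); omega
    | succ d ih =>
      intro h
      have h1 := ih (by omega)
      have h2 := hmono (n + a - c - 1 - (d + 1)) (by omega) (by omega)
      rw [show n + a - c - 1 - (d + 1) + 1 = n + a - c - 1 - d by omega] at h2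
      omega
  refine ⟨a, n - c, by omega, by omega, fun i hi => ?_⟩
  unfold blockFun
  split_ifs with h1 h2
  · exact hmin i h1
  · have e1 := hlow (i - a) (by omega)
    have e2 := hup (n + a - c - 1 - i) (by omega)
    rw [show a + (i - a) = i by omega] at e1
    rw [show n + a - c - 1 - (n + a - c - 1 - i) = i by omega] at e2
    omega
  · exact htail i (by omega) hi

theorem eq_blockPerm_of_avoids {n : ℕ} (π : Equiv.Perm (Fin n))
    (h213 : PermAvoids π p213) (h312 : PermAvoids π p312) (hsq : PermAvoids (π ^ 2) p312) :
    π = 1 ∨ ∃ (a k : ℕ) (h : a + 2 * k ≤ n), 1 ≤ k ∧ π = blockPerm n a k (by omega) := by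
  rw [permAvoids_p213_iff] at h213
  rw [permAvoids_p312_iff] at h312 hsq
  obtain ⟨g, hg⟩ : ∃ g : ℕ → ℕ, ∀ i : Fin n, g i = π i :=
    ⟨fun i => if h : i < n then π ⟨i, h⟩ else i, fun i => by simp⟩
  have hg' : ∀ i (h : i < n), g i = π ⟨i, h⟩ := fun i h => hg ⟨i, h⟩
  have key := eq_blockFun_of_avoids (n := n) (g := g)
    (fun i hi => by rw [hg' i hi]; exact (π _).2)
    (fun i hi j hj h => by
      rw [hg' i hi, hg' j hj] at h
      simpa using π.injective (Fin.ext h))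
    (fun v hv => ⟨π.symm ⟨v, hv⟩, (π.symm _).2, by rw [hg]; simp⟩)
    (fun x y z hxy hyz hz => by
      rw [hg' x (by omega), hg' y (by omega), hg' z hz]
      exact h213 ⟨x, by omega⟩ ⟨y, by omega⟩ ⟨z, hz⟩ hxy hyz)
    (fun x y z hxy hyz hz => by
      rw [hg' x (by omega), hg' y (by omega), hg' z hz]
      exact h312 ⟨x, by omega⟩ ⟨y, by omega⟩ ⟨z, hz⟩ hxy hyz)
    (fun x y z hxy hyz hz => by
      rw [hg' x (by omega), hg' y (by omega), hg' z hz, hg, hg, hg]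
      exact hsq ⟨x, by omega⟩ ⟨y, by omega⟩ ⟨z, hz⟩ hxy hyz)
  rcases key with h | ⟨a, k, hk, hak, h⟩
  · left
    ext i
    rw [← hg, h i i.2]
    rfl
  · refine Or.inr ⟨a, k, hak, hk, ?_⟩
    ext i
    rw [← hg, h i i.2]
    rfl

theorem blockPerm_ne_one {n a k : ℕ} (hk : 1 ≤ k) (h : a + 2 * k ≤ n) :
    blockPerm n a k (by omega) ≠ 1 := by
  intro e
  have h1 : blockFun n a k a = a :=
    congrArg Fin.val (DFunLike.congr_fun e (⟨a, by omega⟩ : Fin n))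
  unfold blockFun at h1
  split_ifs at h1 <;> omega

theorem blockPerm_injective {n a k a' k' : ℕ} (hk : 1 ≤ k) (h : a + 2 * k ≤ n)
    (hk' : 1 ≤ k') (h' : a' + 2 * k' ≤ n)
    (e : blockPerm n a k (by omega) = blockPerm n a' k' (by omega)) : a = a' ∧ k = k' := by
  have h1 : blockFun n a k a = blockFun n a' k' a :=
    congrArg Fin.val (DFunLike.congr_fun e (⟨a, by omega⟩ : Fin n))
  have h2 : blockFun n a k a' = blockFun n a' k' a' :=
    congrArg Fin.val (DFunLike.congr_fun e (⟨a', by omega⟩ : Fin n))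
  unfold blockFun at h1 h2
  split_ifs at h1 h2 <;> omega

theorem sum_range_div_two (n : ℕ) : ∑ m ∈ Finset.range (n + 1), m / 2 = n ^ 2 / 4 := by
  induction n with
  | zero => rfl
  | succ n ih =>
    rw [Finset.sum_range_succ, ih]
    obtain ⟨m, rfl | rfl⟩ := n.even_or_odd'
    · ring_nf
      omega
    · ring_nf
      omega

theorem stmt4 (n : ℕ) (hn : 1 ≤ n) :
    Nat.card {π : Equiv.Perm (Fin n) //
      PermAvoids π p213 ∧ PermAvoids π p312 ∧ PermAvoids (π ^ 2) p312} =
      n ^ 2 / 4 + 1 := by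
  have hle : ∀ x : Σ m : Fin (n + 1), Fin (m / 2), n - x.1 + 2 * (x.2 + 1) ≤ n := by
    rintro ⟨m, j⟩
    have := m.2
    have := j.2
    dsimp only at *
    omega
  have hone : PermAvoids (1 : Equiv.Perm (Fin n)) p213 ∧
      PermAvoids (1 : Equiv.Perm (Fin n)) p312 ∧
      PermAvoids ((1 : Equiv.Perm (Fin n)) ^ 2) p312 := by
    simp only [one_pow, permAvoids_p213_iff, permAvoids_p312_iff, Equiv.Perm.one_apply]
    refine ⟨?_, ?_, ?_⟩ <;> intros <;> omega
  let F : Option (Σ m : Fin (n + 1), Fin (m / 2)) → {π : Equiv.Perm (Fin n) //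
      PermAvoids π p213 ∧ PermAvoids π p312 ∧ PermAvoids (π ^ 2) p312} := fun o =>
    match o with
    | none => ⟨1, hone⟩
    | some x => ⟨_, blockPerm_avoids (hle x)⟩
  have hF : Function.Bijective F := by
    constructor
    · rintro (_ | x) (_ | y) h
      · rfl
      · exact absurd (congrArg Subtype.val h).symm (blockPerm_ne_one (by omega) (hle y))
      · exact absurd (congrArg Subtype.val h) (blockPerm_ne_one (by omega) (hle x))
      · obtain ⟨h1, h2⟩ := blockPerm_injective (by omega) (hle x) (by omega) (hle y)
          (congrArg Subtype.val h)
        obtain ⟨⟨m, hm⟩, ⟨j, hj⟩⟩ := x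
        obtain ⟨⟨m', hm'⟩, ⟨j', hj'⟩⟩ := y
        dsimp only at h1 h2
        obtain rfl : m = m' := by omega
        obtain rfl : j = j' := by omega
        rfl
    · rintro ⟨π, h1, h2, h3⟩
      rcases eq_blockPerm_of_avoids π h1 h2 h3 with rfl | ⟨a, k, h, hk, rfl⟩
      · exact ⟨none, rfl⟩
      · refine ⟨some ⟨⟨n - a, by omega⟩, ⟨k - 1, by dsimp only; omega⟩⟩, Subtype.ext ?_⟩
        have e1 : n - (n - a) = a := by omega
        have e2 : k - 1 + 1 = k := by omega
        simp only [F, e1, e2]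
  rw [← Nat.card_eq_of_bijective F hF, Nat.card_eq_fintype_card, Fintype.card_option,
    Fintype.card_sigma]
  simp only [Fintype.card_fin]
  rw [Fin.sum_univ_eq_sum_range (fun m => m / 2) (n + 1), sum_range_div_two]
end
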